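/- arXiv:2502.18475 — 2 statements merged into one kernel-verified Lean document; each statement's English description precedes it below -/
import Mathlib

section
/- Let μ ∈ ℝ^d, let C ∈ ℝ^{d×d} be invertible, let Z be distributed according to the standard Gaussian measure γ_d on ℝ^d, and set X = μ + C Z. Let f : ℝ^d → ℝ be measurable with E[f(X)²] < ∞. Define γ⁰ = E[f(X)] ∈ ℝ, γ¹ = E[Z f(X)] ∈ ℝ^d, and the symmetric matrix Γ = ½ E[(Z Zᵀ − I_d) f(X)]. Define Θ = C⁻ᵀ Γ C⁻¹ (the unique symmetric matrix with Cᵀ Θ C = Γ), β¹ = C⁻ᵀ γ¹ − 2 Θ μ, and β⁰ = γ⁰ − tr(Γ) − β¹ ⬝ μ − μᵀ Θ μ. Assume all quadratic polynomials are square-integrable against the law of X and that the Gram matrix of the functions (1, x₁,…,x_d, (x_i x_j)_{i≤j}) in L² of the law of X is invertible. Then the quadratic function q(x) = β⁰ + β¹ ⬝ x + xᵀ Θ x is the unique minimiser, over all functions of the form a + b⬝x + xᵀ M x with a ∈ ℝ, b ∈ ℝ^d, M ∈ ℝ^{d×d} symmetric, of the objective E[(q'(X) − f(X))²]. -/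
open MeasureTheory Matrix

noncomputable section

/-- The standard Gaussian measure on `ℝ^d` (product of `d` copies of `N(0,1)`). -/
def stdGaussian (d : ℕ) : Measure (Fin d → ℝ) :=
  Measure.pi fun _ => ProbabilityTheory.gaussianReal 0 1

lemma sg_iter (n : ℕ) : ∫ x, x ^ n ∂(ProbabilityTheory.gaussianReal 0 1) =
    iteratedDeriv n (fun t : ℝ => Real.exp (t ^ 2 / 2)) 0 := by
  have h := ProbabilityTheory.iteratedDeriv_mgf_zero (X := fun x : ℝ => x)
    (μ := ProbabilityTheory.gaussianReal 0 1) (by simp) n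
  rw [ProbabilityTheory.mgf_fun_id_gaussianReal] at h
  simp at h
  rw [h]

lemma sg_deriv (p p' : ℝ → ℝ) (hp : ∀ t, HasDerivAt p (p' t) t) :
    deriv (fun t : ℝ => p t * Real.exp (t ^ 2 / 2)) =
      fun t => (p' t + t * p t) * Real.exp (t ^ 2 / 2) := by
  funext t
  have h1 : HasDerivAt (fun t : ℝ => t ^ 2 / 2) t t := by
    have := (hasDerivAt_pow 2 t).div_const 2
    simpa using this
  have := (hp t).mul h1.exp
  have h2 := this.deriv
  simp only [Pi.mul_def] at h2
  rw [h2]; ring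

lemma sg_d1 : deriv (fun t : ℝ => Real.exp (t ^ 2 / 2)) = fun t => t * Real.exp (t ^ 2 / 2) := by
  have := sg_deriv (fun _ => 1) (fun _ => 0) (fun t => hasDerivAt_const t 1)
  simpa using this

lemma sg_d2 : deriv (fun t : ℝ => t * Real.exp (t ^ 2 / 2)) =
    fun t => (1 + t * t) * Real.exp (t ^ 2 / 2) :=
  sg_deriv (fun t => t) (fun _ => 1) (fun t => hasDerivAt_id t)

lemma sg_d3 : deriv (fun t : ℝ => (1 + t * t) * Real.exp (t ^ 2 / 2)) =
    fun t => (t + t + t * (1 + t * t)) * Real.exp (t ^ 2 / 2) :=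
  sg_deriv (fun t => 1 + t * t) (fun t => t + t) (fun t => by
    simpa using ((hasDerivAt_id t).mul (hasDerivAt_id t)).const_add 1)

lemma sg_d4 : deriv (fun t : ℝ => (t + t + t * (1 + t * t)) * Real.exp (t ^ 2 / 2)) =
    fun t => (3 + 3 * t ^ 2 + t * (t + t + t * (1 + t * t))) * Real.exp (t ^ 2 / 2) :=
  sg_deriv (fun t => t + t + t * (1 + t * t)) (fun t => 3 + 3 * t ^ 2) (fun t => by
    have h := ((hasDerivAt_id t).mul (hasDerivAt_id t)).const_add 1
    have h2 := ((hasDerivAt_id t).add (hasDerivAt_id t)).add ((hasDerivAt_id t).mul h)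
    refine HasDerivAt.congr_deriv h2 ?_
    simp; ring)

lemma sg_m1 : ∫ x, x ∂(ProbabilityTheory.gaussianReal 0 1) = 0 := by simp
lemma sg_m2 : ∫ x, x ^ 2 ∂(ProbabilityTheory.gaussianReal 0 1) = 1 := by
  rw [sg_iter]; simp [iteratedDeriv_succ, iteratedDeriv_zero, sg_d1, sg_d2]
lemma sg_m3 : ∫ x, x ^ 3 ∂(ProbabilityTheory.gaussianReal 0 1) = 0 := by
  rw [sg_iter]; simp [iteratedDeriv_succ, iteratedDeriv_zero, sg_d1, sg_d2, sg_d3]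
lemma sg_m4 : ∫ x, x ^ 4 ∂(ProbabilityTheory.gaussianReal 0 1) = 3 := by
  rw [sg_iter]; simp [iteratedDeriv_succ, iteratedDeriv_zero, sg_d1, sg_d2, sg_d3, sg_d4]

instance (d : ℕ) : IsProbabilityMeasure (stdGaussian d) := by
  unfold stdGaussian; infer_instance

lemma sg_prod {d : ℕ} (e : Fin d → ℕ) :
    ∫ z, ∏ m, z m ^ e m ∂(stdGaussian d) =
      ∏ m, ∫ x, x ^ e m ∂(ProbabilityTheory.gaussianReal 0 1) := by
  unfold stdGaussian
  exact integral_fintype_prod_eq_prod (fun m x => x ^ e m)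

lemma sg_E1 {d : ℕ} (i : Fin d) : ∫ z, z i ∂(stdGaussian d) = 0 := by
  have h := sg_prod (fun m => if i = m then 1 else 0)
  have : ∀ z : Fin d → ℝ, ∏ m, z m ^ (if i = m then 1 else 0) = z i := fun z => by
    simp [pow_ite]
  simp only [this] at h
  rw [h]
  exact Finset.prod_eq_zero (Finset.mem_univ i) (by simp)

lemma sg_E2 {d : ℕ} (i j : Fin d) :
    ∫ z, z i * z j ∂(stdGaussian d) = if i = j then 1 else 0 := by
  have h := sg_prod (fun m => (if i = m then 1 else 0) + (if j = m then 1 else 0))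
  have : ∀ z : Fin d → ℝ, ∏ m, z m ^ ((if i = m then 1 else 0) + (if j = m then 1 else 0))
      = z i * z j := fun z => by
    simp only [pow_add, Finset.prod_mul_distrib]; simp [pow_ite]
  simp only [this] at h
  rw [h]
  split_ifs with hij
  · subst hij
    refine Finset.prod_eq_one fun m _ => ?_
    by_cases h : i = m <;> simp [h, sg_m2]
  · exact Finset.prod_eq_zero (Finset.mem_univ i) (by simp [Ne.symm hij])

lemma sg_E3 {d : ℕ} (i j k : Fin d) :
    ∫ z, z i * z j * z k ∂(stdGaussian d) = 0 := by
  have h := sg_prod (fun m => (if i = m then 1 else 0) + (if j = m then 1 else 0)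
    + (if k = m then 1 else 0))
  have : ∀ z : Fin d → ℝ, ∏ m, z m ^ ((if i = m then 1 else 0) + (if j = m then 1 else 0)
      + (if k = m then 1 else 0)) = z i * z j * z k := fun z => by
    simp only [pow_add, Finset.prod_mul_distrib]; simp [pow_ite]
  simp only [this] at h
  rw [h]
  by_cases hij : i = j
  · subst hij
    by_cases hik : i = k
    · subst hik
      exact Finset.prod_eq_zero (Finset.mem_univ i) (by simp [sg_m3])
    · exact Finset.prod_eq_zero (Finset.mem_univ k) (by simp [hik])
  · by_cases hik : i = k
    · subst hik
      exact Finset.prod_eq_zero (Finset.mem_univ j) (by simp [hij])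
    · exact Finset.prod_eq_zero (Finset.mem_univ i) (by simp [Ne.symm hij, Ne.symm hik])

lemma sg_E4 {d : ℕ} (i j k l : Fin d) :
    ∫ z, z i * z j * (z k * z l) ∂(stdGaussian d) =
      (if i = j then 1 else 0) * (if k = l then 1 else 0)
      + (if i = k then 1 else 0) * (if j = l then 1 else 0)
      + (if i = l then 1 else 0) * (if j = k then 1 else 0) := by
  have h := sg_prod (fun m => (if i = m then 1 else 0) + (if j = m then 1 else 0)
    + ((if k = m then 1 else 0) + (if l = m then 1 else 0)))
  have : ∀ z : Fin d → ℝ, ∏ m, z m ^ ((if i = m then 1 else 0) + (if j = m then 1 else 0)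
      + ((if k = m then 1 else 0) + (if l = m then 1 else 0))) = z i * z j * (z k * z l) :=
    fun z => by
    simp only [pow_add, Finset.prod_mul_distrib]; simp [pow_ite]
  simp only [this] at h
  rw [h]
  by_cases hij : i = j
  · subst hij
    by_cases hkl : k = l
    · subst hkl
      by_cases hik : i = k
      · subst hik
        rw [Finset.prod_eq_single i]
        · simp [sg_m4]; norm_num
        · intro m _ hm; simp [Ne.symm hm]
        · simp
      · simp only [hik]
        simp
        refine Finset.prod_eq_one fun m _ => ?_
        by_cases h1 : i = m
        · subst h1; simp [Ne.symm hik, sg_m2]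
        · by_cases h2 : k = m <;> simp [h1, h2, sg_m2]
    · by_cases hik : i = k
      · subst hik
        simp [hkl]
        exact Finset.prod_eq_zero (Finset.mem_univ l) (by simp [hkl])
      · simp [hkl, hik]
        exact Finset.prod_eq_zero (Finset.mem_univ k) (by simp [hik, Ne.symm hkl])
  · by_cases hik : i = k
    · subst hik
      by_cases hjl : j = l
      · subst hjl
        simp [hij]
        refine Finset.prod_eq_one fun m _ => ?_
        by_cases h1 : i = m
        · subst h1; simp [Ne.symm hij, sg_m2]
        · by_cases h2 : j = m <;> simp [h1, h2, sg_m2]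
      · simp [hij, hjl, Ne.symm hij]
        exact Finset.prod_eq_zero (Finset.mem_univ j) (by simp [hij, Ne.symm hjl])
    · by_cases hil : i = l
      · subst hil
        by_cases hjk : j = k
        · subst hjk
          simp [hij]
          refine Finset.prod_eq_one fun m _ => ?_
          by_cases h1 : i = m
          · subst h1; simp [Ne.symm hij, sg_m2]
          · by_cases h2 : j = m <;> simp [h1, h2, sg_m2]
        · simp [hij, hjk, hik]
          exact Finset.prod_eq_zero (Finset.mem_univ j) (by simp [hij, Ne.symm hjk])
      · simp [hij, hik, hil]
        exact Finset.prod_eq_zero (Finset.mem_univ i)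
          (by simp [Ne.symm hij, Ne.symm hik, Ne.symm hil])

lemma sg_memLp {d : ℕ} (i : Fin d) (p : ENNReal) (hp : p ≠ ⊤) :
    MemLp (fun z : Fin d → ℝ => z i) p (stdGaussian d) :=
  (ProbabilityTheory.memLp_id_gaussianReal' p hp).comp_measurePreserving
    (measurePreserving_eval (fun _ : Fin d => ProbabilityTheory.gaussianReal 0 1) i)

lemma sg_memLp2 {d : ℕ} (i j : Fin d) :
    MemLp (fun z : Fin d → ℝ => z i * z j) 2 (stdGaussian d) := by
  have : ENNReal.HolderTriple 4 4 2 := ⟨by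
    rw [← ENNReal.toReal_eq_toReal_iff' (by simp) (by simp), ENNReal.toReal_add (by simp) (by simp)]
    norm_num⟩
  exact (sg_memLp j 4 (by simp)).mul' (sg_memLp i 4 (by simp))

/-- quadratic in z -/
def sgq {d : ℕ} (A : ℝ) (B : Fin d → ℝ) (N : Matrix (Fin d) (Fin d) ℝ) (z : Fin d → ℝ) : ℝ :=
  A + ∑ i, B i * z i + ∑ i, ∑ j, N i j * (z i * z j)

lemma sgq_memLp {d : ℕ} (A : ℝ) (B : Fin d → ℝ) (N : Matrix (Fin d) (Fin d) ℝ) :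
    MemLp (sgq A B N) 2 (stdGaussian d) := by
  unfold sgq
  refine ((memLp_const A).add (memLp_finsetSum _ fun i _ => ?_)).add
    (memLp_finsetSum _ fun i _ => memLp_finsetSum _ fun j _ => ?_)
  · exact (sg_memLp i 2 (by simp)).const_mul _
  · exact (sg_memLp2 i j).const_mul _

lemma sg_i1 {d : ℕ} (i : Fin d) {g : (Fin d → ℝ) → ℝ} (hg : MemLp g 2 (stdGaussian d)) :
    Integrable (fun z => z i * g z) (stdGaussian d) :=
  (sg_memLp i 2 (by simp)).integrable_mul hg

lemma sg_i2 {d : ℕ} (i j : Fin d) {g : (Fin d → ℝ) → ℝ} (hg : MemLp g 2 (stdGaussian d)) :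
    Integrable (fun z => z i * z j * g z) (stdGaussian d) :=
  (sg_memLp2 i j).integrable_mul hg

lemma sgq_int {d : ℕ} (A : ℝ) (B : Fin d → ℝ) (N : Matrix (Fin d) (Fin d) ℝ)
    (g : (Fin d → ℝ) → ℝ) (hg : MemLp g 2 (stdGaussian d)) :
    ∫ z, sgq A B N z * g z ∂(stdGaussian d) = A * ∫ z, g z ∂(stdGaussian d)
      + ∑ i, B i * ∫ z, z i * g z ∂(stdGaussian d)
      + ∑ i, ∑ j, N i j * ∫ z, z i * z j * g z ∂(stdGaussian d) := by
  have h0 : Integrable (fun z => A * g z) (stdGaussian d) :=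
    (hg.integrable (by norm_num)).const_mul A
  have h1 : ∀ i, Integrable (fun z => B i * (z i * g z)) (stdGaussian d) := fun i =>
    (sg_i1 i hg).const_mul _
  have h2 : ∀ i j, Integrable (fun z => N i j * (z i * z j * g z)) (stdGaussian d) := fun i j =>
    (sg_i2 i j hg).const_mul _
  have hsumone : Integrable (fun z => ∑ i, B i * (z i * g z)) (stdGaussian d) :=
    integrable_finsetSum _ fun i _ => h1 i
  have hsumrow : ∀ i, Integrable (fun z => ∑ j, N i j * (z i * z j * g z)) (stdGaussian d) :=
    fun i => integrable_finsetSum _ fun j _ => h2 i j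
  have hsumtwo : Integrable (fun z => ∑ i, ∑ j, N i j * (z i * z j * g z)) (stdGaussian d) :=
    integrable_finsetSum _ fun i _ => hsumrow i
  have h01 : Integrable (fun z => A * g z + ∑ i, B i * (z i * g z)) (stdGaussian d) :=
    h0.add hsumone
  have e : ∀ z, sgq A B N z * g z = A * g z + ∑ i, B i * (z i * g z)
      + ∑ i, ∑ j, N i j * (z i * z j * g z) := fun z => by
    simp only [sgq, add_mul, Finset.sum_mul, mul_assoc]
  simp only [e]
  rw [integral_add h01 hsumtwo, integral_add h0 hsumone, integral_const_mul,
    integral_finsetSum _ (fun i _ => h1 i), integral_finsetSum _ (fun i _ => hsumrow i)]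
  congr 1
  · simp only [integral_const_mul]
  · refine Finset.sum_congr rfl fun i _ => ?_
    rw [integral_finsetSum _ (fun j _ => h2 i j)]
    simp only [integral_const_mul]

lemma sg_orth {d : ℕ} (F : (Fin d → ℝ) → ℝ) (hF : MemLp F 2 (stdGaussian d))
    (Γ : Matrix (Fin d) (Fin d) ℝ)
    (hΓ : ∀ i j, Γ i j = (1 / 2) * ∫ z, (z i * z j - if i = j then 1 else 0) * F z ∂stdGaussian d)
    (hΓs : ∀ i j, Γ i j = Γ j i)
    (A : ℝ) (B : Fin d → ℝ) (N : Matrix (Fin d) (Fin d) ℝ) :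
    ∫ z, sgq A B N z * (sgq ((∫ z, F z ∂stdGaussian d) - Γ.trace)
      (fun i => ∫ z, z i * F z ∂stdGaussian d) Γ z - F z) ∂(stdGaussian d) = 0 := by
  set A0 := (∫ z, F z ∂stdGaussian d) - Γ.trace with hA0
  set B0 : Fin d → ℝ := fun i => ∫ z, z i * F z ∂stdGaussian d with hB0
  have hq := sgq_memLp A0 B0 Γ
  have hF1 := hF.integrable (q := 2) (by norm_num)
  have hG : ∀ i j, ∫ z, z i * z j * F z ∂(stdGaussian d) =
      2 * Γ i j + (if i = j then 1 else 0) * ∫ z, F z ∂stdGaussian d := fun i j => by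
    rw [hΓ]
    simp only [sub_mul]
    rw [integral_sub (sg_i2 i j hF) (hF1.const_mul _), integral_const_mul]
    ring
  have hqF : MemLp (fun z => sgq A0 B0 Γ z - F z) 2 (stdGaussian d) := hq.sub hF
  rw [sgq_int _ _ _ _ hqF]
  have t0 : ∫ z, (sgq A0 B0 Γ z - F z) ∂(stdGaussian d) = 0 := by
    rw [integral_sub (hq.integrable (by norm_num)) hF1]
    have := sgq_int A0 B0 Γ (fun _ => 1) (memLp_const 1)
    simp only [mul_one] at this
    rw [this]
    simp [sg_E1, sg_E2, hA0, Matrix.trace]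
  have t1 : ∀ i, ∫ z, z i * (sgq A0 B0 Γ z - F z) ∂(stdGaussian d) = 0 := fun i => by
    have hz := sg_memLp i 2 (by simp)
    simp only [mul_sub]
    rw [integral_sub (sg_i1 i hq) (sg_i1 i hF)]
    have := sgq_int A0 B0 Γ _ hz
    simp only [mul_comm _ (sgq _ _ _ _)]
    rw [this]
    simp [sg_E1, sg_E2, sg_E3, hB0]
  have t2 : ∀ i j, ∫ z, z i * z j * (sgq A0 B0 Γ z - F z) ∂(stdGaussian d) = 0 := fun i j => by
    have hz := sg_memLp2 i j
    simp only [mul_sub]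
    rw [integral_sub (sg_i2 i j hq) (sg_i2 i j hF)]
    have := sgq_int A0 B0 Γ _ hz
    simp only [mul_comm _ (sgq _ _ _ _)]
    rw [this, hG]
    have e3 : ∀ k, ∫ z : Fin d → ℝ, z k * (z i * z j) ∂(stdGaussian d) = 0 := fun k => by
      simpa only [mul_assoc] using sg_E3 k i j
    have e4 := fun k l => sg_E4 k l i j
    have s1 : ∑ k, ∑ l, Γ k l * ((if k = l then (1 : ℝ) else 0) * (if i = j then 1 else 0))
        = Γ.trace * (if i = j then 1 else 0) := by
      simp only [← mul_assoc, ← Finset.sum_mul]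
      simp [Matrix.trace]
    have s2 : ∑ k, ∑ l, Γ k l * ((if k = i then (1 : ℝ) else 0) * (if l = j then 1 else 0))
        = Γ i j := by
      simp
    have s3 : ∑ k, ∑ l, Γ k l * ((if k = j then (1 : ℝ) else 0) * (if l = i then 1 else 0))
        = Γ j i := by
      simp
    simp only [e3, e4, sg_E2, mul_add, Finset.sum_add_distrib, s1, s2, s3, hΓs j i, hA0]
    simp only [mul_zero, Finset.sum_const_zero]
    ring
  simp [t0, t1, t2]

lemma sg_conv {d : ℕ} (μv : Fin d → ℝ) (C : Matrix (Fin d) (Fin d) ℝ)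
    (a : ℝ) (b : Fin d → ℝ) (M : Matrix (Fin d) (Fin d) ℝ) (hM : M.IsSymm) (z : Fin d → ℝ) :
    a + b ⬝ᵥ (μv + C *ᵥ z) + (μv + C *ᵥ z) ⬝ᵥ (M *ᵥ (μv + C *ᵥ z)) =
      sgq (a + b ⬝ᵥ μv + μv ⬝ᵥ (M *ᵥ μv)) (Cᵀ *ᵥ (b + (2 : ℝ) • (M *ᵥ μv))) (Cᵀ * M * C) z := by
  have e1 : ∀ w : Fin d → ℝ, (Cᵀ *ᵥ w) ⬝ᵥ z = w ⬝ᵥ (C *ᵥ z) := fun w => by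
    rw [mulVec_transpose, dotProduct_mulVec]
  have e2 : ∑ i, ∑ j, (Cᵀ * M * C) i j * (z i * z j) = (C *ᵥ z) ⬝ᵥ (M *ᵥ (C *ᵥ z)) := by
    rw [dotProduct_comm, ← e1, mulVec_mulVec, mulVec_mulVec, dotProduct_comm]
    simp only [dotProduct, mulVec, Finset.mul_sum]
    refine Finset.sum_congr rfl fun i _ => Finset.sum_congr rfl fun j _ => by ring
  have e3 : μv ⬝ᵥ (M *ᵥ (C *ᵥ z)) = (M *ᵥ μv) ⬝ᵥ (C *ᵥ z) := by
    rw [dotProduct_mulVec, ← mulVec_transpose, hM.eq]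
  have e4 : (C *ᵥ z) ⬝ᵥ (M *ᵥ μv) = (M *ᵥ μv) ⬝ᵥ (C *ᵥ z) := dotProduct_comm _ _
  unfold sgq
  rw [e2]
  change _ = _ + (Cᵀ *ᵥ (b + (2 : ℝ) • (M *ᵥ μv))) ⬝ᵥ z + _
  rw [e1]
  simp only [mulVec_add, dotProduct_add, add_dotProduct, smul_dotProduct, e3, e4, smul_eq_mul]
  ring

/-- Full-covariance least squares: with `X = μ + C Z`, `Z ∼ N(0, I_d)`,
`C` invertible and `E[f(X)²] < ∞`, set `γ⁰ = E[f(X)]`, `γ¹ = E[Z f(X)]`,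
`Γ = ½ E[(Z Zᵀ − I_d) f(X)]`, `Θ = C⁻ᵀ Γ C⁻¹`, `β¹ = C⁻ᵀ γ¹ − 2 Θ μ` and
`β⁰ = γ⁰ − tr(Γ) − β¹ ⬝ μ − μᵀ Θ μ`. Assuming all quadratic polynomials are square
integrable against the law of `X` and the quadratic family is linearly independent in
`L²` of the law of `X` (invertibility of its Gram matrix), the quadratic function
`q(x) = β⁰ + β¹ ⬝ x + xᵀ Θ x` is the unique minimiser of `E[(q'(X) − f(X))²]` over all
`q'(x) = a + b ⬝ x + xᵀ M x` with `M` symmetric. -/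
theorem stmt8
    {d : ℕ} (μv : Fin d → ℝ) (C : Matrix (Fin d) (Fin d) ℝ) (hC : IsUnit C.det)
    (f : (Fin d → ℝ) → ℝ) (hf : Measurable f)
    (hfL2 : Integrable (fun z => (f (μv + C *ᵥ z)) ^ 2) (stdGaussian d))
    -- all quadratic polynomials are square-integrable against the law of `X`
    (hquadL2 : ∀ (a : ℝ) (b : Fin d → ℝ) (M : Matrix (Fin d) (Fin d) ℝ),
      Integrable
        (fun z => (a + b ⬝ᵥ (μv + C *ᵥ z) + (μv + C *ᵥ z) ⬝ᵥ (M *ᵥ (μv + C *ᵥ z))) ^ 2)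
        (stdGaussian d))
    -- the Gram matrix of `(1, x_i, x_i x_j)` in `L²` of the law of `X` is invertible,
    -- i.e. the quadratic family is linearly independent in `L²` of the law of `X`
    (hGram : ∀ (a : ℝ) (b : Fin d → ℝ) (M : Matrix (Fin d) (Fin d) ℝ), M.IsSymm →
      (∀ᵐ z ∂stdGaussian d,
        a + b ⬝ᵥ (μv + C *ᵥ z) + (μv + C *ᵥ z) ⬝ᵥ (M *ᵥ (μv + C *ᵥ z)) = 0) →
      a = 0 ∧ b = 0 ∧ M = 0)
    (γ0 : ℝ) (hγ0 : γ0 = ∫ z, f (μv + C *ᵥ z) ∂stdGaussian d)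
    (γ1 : Fin d → ℝ) (hγ1 : γ1 = fun i => ∫ z, z i * f (μv + C *ᵥ z) ∂stdGaussian d)
    (Γ : Matrix (Fin d) (Fin d) ℝ)
    (hΓ : Γ = Matrix.of fun i j =>
      (1 / 2) * ∫ z, (z i * z j - if i = j then 1 else 0) * f (μv + C *ᵥ z) ∂stdGaussian d)
    (Θ : Matrix (Fin d) (Fin d) ℝ) (hΘ : Θ = (C⁻¹)ᵀ * Γ * C⁻¹)
    (β1 : Fin d → ℝ) (hβ1 : β1 = (C⁻¹)ᵀ *ᵥ γ1 - (2 : ℝ) • (Θ *ᵥ μv))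
    (β0 : ℝ) (hβ0 : β0 = γ0 - Γ.trace - β1 ⬝ᵥ μv - μv ⬝ᵥ (Θ *ᵥ μv)) :
    -- `q` minimises the least-squares objective over symmetric quadratics ...
    (∀ (a : ℝ) (b : Fin d → ℝ) (M : Matrix (Fin d) (Fin d) ℝ), M.IsSymm →
      (∫ z, (β0 + β1 ⬝ᵥ (μv + C *ᵥ z) + (μv + C *ᵥ z) ⬝ᵥ (Θ *ᵥ (μv + C *ᵥ z))
          - f (μv + C *ᵥ z)) ^ 2 ∂stdGaussian d)
        ≤ ∫ z, (a + b ⬝ᵥ (μv + C *ᵥ z) + (μv + C *ᵥ z) ⬝ᵥ (M *ᵥ (μv + C *ᵥ z))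
            - f (μv + C *ᵥ z)) ^ 2 ∂stdGaussian d)
    ∧
    -- ... and it is the unique such minimiser
    (∀ (a : ℝ) (b : Fin d → ℝ) (M : Matrix (Fin d) (Fin d) ℝ), M.IsSymm →
      (∀ (a' : ℝ) (b' : Fin d → ℝ) (M' : Matrix (Fin d) (Fin d) ℝ), M'.IsSymm →
        (∫ z, (a + b ⬝ᵥ (μv + C *ᵥ z) + (μv + C *ᵥ z) ⬝ᵥ (M *ᵥ (μv + C *ᵥ z))
            - f (μv + C *ᵥ z)) ^ 2 ∂stdGaussian d)
          ≤ ∫ z, (a' + b' ⬝ᵥ (μv + C *ᵥ z) + (μv + C *ᵥ z) ⬝ᵥ (M' *ᵥ (μv + C *ᵥ z))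
              - f (μv + C *ᵥ z)) ^ 2 ∂stdGaussian d) →
      a = β0 ∧ b = β1 ∧ M = Θ) := by
  set F : (Fin d → ℝ) → ℝ := fun z => f (μv + C *ᵥ z) with hFdef
  have hFm : Measurable F := hf.comp (by fun_prop)
  have hF : MemLp F 2 (stdGaussian d) :=
    (memLp_two_iff_integrable_sq hFm.aestronglyMeasurable).2 hfL2
  have hΓ' : ∀ i j, Γ i j =
      (1 / 2) * ∫ z, (z i * z j - if i = j then 1 else 0) * F z ∂stdGaussian d := fun i j => by
    rw [hΓ]; rfl
  have hΓs : ∀ i j, Γ i j = Γ j i := fun i j => by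
    rw [hΓ', hΓ']
    simp only [mul_comm (_ : ℝ), eq_comm (a := i)]
  have hΓS : Γ.IsSymm := by ext i j; exact hΓs j i
  have hΘS : Θ.IsSymm := by
    rw [hΘ, Matrix.IsSymm, transpose_mul, transpose_mul, transpose_transpose, hΓS.eq,
      Matrix.mul_assoc]
  have hCC : C⁻¹ * C = 1 := nonsing_inv_mul C hC
  have hCT : Cᵀ * (C⁻¹)ᵀ = 1 := by rw [← transpose_mul, hCC, transpose_one]
  have hN : Cᵀ * Θ * C = Γ := by
    rw [hΘ]
    calc Cᵀ * ((C⁻¹)ᵀ * Γ * C⁻¹) * C = (Cᵀ * (C⁻¹)ᵀ) * Γ * (C⁻¹ * C) := by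
          simp only [Matrix.mul_assoc]
      _ = Γ := by rw [hCT, hCC, Matrix.one_mul, Matrix.mul_one]
  have hB : Cᵀ *ᵥ (β1 + (2 : ℝ) • (Θ *ᵥ μv)) = γ1 := by
    rw [hβ1, sub_add_cancel, mulVec_mulVec, hCT, one_mulVec]
  have hA : β0 + β1 ⬝ᵥ μv + μv ⬝ᵥ (Θ *ᵥ μv) = γ0 - Γ.trace := by rw [hβ0]; ring
  have hq : ∀ z, β0 + β1 ⬝ᵥ (μv + C *ᵥ z) + (μv + C *ᵥ z) ⬝ᵥ (Θ *ᵥ (μv + C *ᵥ z)) =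
      sgq (γ0 - Γ.trace) γ1 Γ z := fun z => by
    rw [sg_conv μv C β0 β1 Θ hΘS z, hA, hB, hN]
  have horth : ∀ A B N, ∫ z, sgq A B N z * (sgq (γ0 - Γ.trace) γ1 Γ z - F z) ∂(stdGaussian d)
      = 0 := fun A B N => by
    rw [hγ0, hγ1]
    exact sg_orth F hF Γ hΓ' hΓs A B N
  have hr : MemLp (fun z => sgq (γ0 - Γ.trace) γ1 Γ z - F z) 2 (stdGaussian d) :=
    (sgq_memLp _ _ _).sub hF
  -- Pythagoras
  have key : ∀ (a : ℝ) (b : Fin d → ℝ) (M : Matrix (Fin d) (Fin d) ℝ), M.IsSymm →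
      ∃ h : (Fin d → ℝ) → ℝ, MemLp h 2 (stdGaussian d) ∧
        (∀ z, (a - β0) + (b - β1) ⬝ᵥ (μv + C *ᵥ z)
          + (μv + C *ᵥ z) ⬝ᵥ ((M - Θ) *ᵥ (μv + C *ᵥ z)) = h z) ∧
        ∫ z, (a + b ⬝ᵥ (μv + C *ᵥ z) + (μv + C *ᵥ z) ⬝ᵥ (M *ᵥ (μv + C *ᵥ z))
            - f (μv + C *ᵥ z)) ^ 2 ∂stdGaussian d =
          ∫ z, (β0 + β1 ⬝ᵥ (μv + C *ᵥ z) + (μv + C *ᵥ z) ⬝ᵥ (Θ *ᵥ (μv + C *ᵥ z))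
            - f (μv + C *ᵥ z)) ^ 2 ∂stdGaussian d + ∫ z, h z ^ 2 ∂stdGaussian d := by
    intro a b M hM
    have hc := sg_conv μv C (a - β0) (b - β1) (M - Θ) (hM.sub hΘS)
    refine ⟨_, sgq_memLp _ _ _, hc, ?_⟩
    have ho := horth ((a - β0) + (b - β1) ⬝ᵥ μv + μv ⬝ᵥ ((M - Θ) *ᵥ μv))
      (Cᵀ *ᵥ ((b - β1) + (2 : ℝ) • ((M - Θ) *ᵥ μv))) (Cᵀ * (M - Θ) * C)
    have hh := sgq_memLp ((a - β0) + (b - β1) ⬝ᵥ μv + μv ⬝ᵥ ((M - Θ) *ᵥ μv))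
      (Cᵀ *ᵥ ((b - β1) + (2 : ℝ) • ((M - Θ) *ᵥ μv))) (Cᵀ * (M - Θ) * C)
    set h := sgq ((a - β0) + (b - β1) ⬝ᵥ μv + μv ⬝ᵥ ((M - Θ) *ᵥ μv))
      (Cᵀ *ᵥ ((b - β1) + (2 : ℝ) • ((M - Θ) *ᵥ μv))) (Cᵀ * (M - Θ) * C) with hhd
    have e : ∀ z, (a + b ⬝ᵥ (μv + C *ᵥ z) + (μv + C *ᵥ z) ⬝ᵥ (M *ᵥ (μv + C *ᵥ z))
            - f (μv + C *ᵥ z)) ^ 2 = (sgq (γ0 - Γ.trace) γ1 Γ z - F z) ^ 2 + h z ^ 2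
            + 2 * (h z * (sgq (γ0 - Γ.trace) γ1 Γ z - F z)) := fun z => by
      rw [← hq z, ← hc z, sub_dotProduct, sub_mulVec, dotProduct_sub]
      simp only [hFdef]
      ring
    have i1 : Integrable (fun z => (sgq (γ0 - Γ.trace) γ1 Γ z - F z) ^ 2) (stdGaussian d) :=
      hr.integrable_sq
    have i2 : Integrable (fun z => h z ^ 2) (stdGaussian d) := hh.integrable_sq
    have i3 : Integrable (fun z => h z * (sgq (γ0 - Γ.trace) γ1 Γ z - F z)) (stdGaussian d) :=
      hh.integrable_mul hr
    have i12 : Integrable (fun z => (sgq (γ0 - Γ.trace) γ1 Γ z - F z) ^ 2 + h z ^ 2)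
      (stdGaussian d) := i1.add i2
    simp only [e, hq]
    rw [integral_add i12 (i3.const_mul 2), integral_add i1 i2, integral_const_mul, ho]
    simp [hFdef]
  refine ⟨fun a b M hM => ?_, fun a b M hM hmin => ?_⟩
  · obtain ⟨h, -, -, he⟩ := key a b M hM
    rw [he]
    have : 0 ≤ ∫ z, h z ^ 2 ∂stdGaussian d := integral_nonneg fun z => sq_nonneg _
    linarith
  · obtain ⟨h, hh, hc, he⟩ := key a b M hM
    have h1 := hmin β0 β1 Θ hΘS
    rw [he] at h1
    have h0 : 0 ≤ ∫ z, h z ^ 2 ∂stdGaussian d := integral_nonneg fun z => sq_nonneg _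
    have h2 : ∫ z, h z ^ 2 ∂stdGaussian d = 0 := by linarith
    rw [integral_eq_zero_iff_of_nonneg (fun z => sq_nonneg _) hh.integrable_sq] at h2
    obtain ⟨ha, hb, hMz⟩ := hGram (a - β0) (b - β1) (M - Θ) (hM.sub hΘS) (by
      filter_upwards [h2] with z hz
      rw [hc z]
      simpa using hz)
    exact ⟨sub_eq_zero.1 ha, sub_eq_zero.1 hb, sub_eq_zero.1 hMz⟩
end
end

section
/- Let μ ∈ ℝ^d, let C ∈ ℝ^{d×d} be invertible, let Z ∼ γ_d, and set X = μ + C Z. Let f : ℝ^d → ℝ be twice continuously differentiable with |f|, ‖∇f‖, ‖∇²f‖ bounded by a polynomial in ‖x‖, and suppose the matrix H := E[∇²f(X)] is negative definite. Let (β⁰, β¹, Θ) with Θ symmetric be the unique minimiser over (a, b, M), a ∈ ℝ, b ∈ ℝ^d, M symmetric, of E[(a + b ⬝ X + Xᵀ M X − f(X))²] (assuming this minimiser exists and is unique). Then Θ = ½ H and β¹ = g − H μ, where g = E[∇f(X)]; consequently the Gaussian density proportional to exp(β¹ ⬝ x + xᵀ Θ x) has mean μ' = μ − H⁻¹ g and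 covariance matrix Σ' = −H⁻¹. -/
open MeasureTheory Matrix

noncomputable section

/-- Continuous function of polynomial growth. -/
def PolyGrowth {d : ℕ} (F : (Fin d → ℝ) → ℝ) : Prop :=
  Continuous F ∧ ∃ (c : ℝ) (n : ℕ), ∀ x, |F x| ≤ c * (1 + ‖x‖) ^ n

lemma PolyGrowth.nonneg_bound {d : ℕ} {F : (Fin d → ℝ) → ℝ} (h : PolyGrowth F) :
    ∃ (c : ℝ) (n : ℕ), 0 ≤ c ∧ ∀ x, |F x| ≤ c * (1 + ‖x‖) ^ n := by
  obtain ⟨_, c, n, hb⟩ := h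
  refine ⟨|c|, n, abs_nonneg _, fun x => (hb x).trans ?_⟩
  gcongr
  exact le_abs_self c

lemma PolyGrowth.mul {d : ℕ} {F G : (Fin d → ℝ) → ℝ} (hF : PolyGrowth F) (hG : PolyGrowth G) :
    PolyGrowth (fun x => F x * G x) := by
  obtain ⟨c, n, hc, hb⟩ := hF.nonneg_bound
  obtain ⟨c', n', hc', hb'⟩ := hG.nonneg_bound
  refine ⟨hF.1.mul hG.1, c * c', n + n', fun x => ?_⟩
  rw [abs_mul]
  calc |F x| * |G x| ≤ (c * (1 + ‖x‖) ^ n) * (c' * (1 + ‖x‖) ^ n') := by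
        gcongr
        · exact hb x
        · exact hb' x
    _ = _ := by ring

lemma PolyGrowth.add {d : ℕ} {F G : (Fin d → ℝ) → ℝ} (hF : PolyGrowth F) (hG : PolyGrowth G) :
    PolyGrowth (fun x => F x + G x) := by
  obtain ⟨c, n, hc, hb⟩ := hF.nonneg_bound
  obtain ⟨c', n', hc', hb'⟩ := hG.nonneg_bound
  refine ⟨hF.1.add hG.1, c + c', n + n', fun x => ?_⟩
  have h1 : (1:ℝ) ≤ 1 + ‖x‖ := by linarith [norm_nonneg x]
  calc |F x + G x| ≤ |F x| + |G x| := abs_add_le _ _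
    _ ≤ (c * (1 + ‖x‖) ^ n) + (c' * (1 + ‖x‖) ^ n') := add_le_add (hb x) (hb' x)
    _ ≤ (c * (1 + ‖x‖) ^ (n + n')) + (c' * (1 + ‖x‖) ^ (n + n')) := by
        gcongr
        · omega
        · omega
    _ = _ := by ring

lemma PolyGrowth.const {d : ℕ} (a : ℝ) : PolyGrowth (fun _ : Fin d → ℝ => a) :=
  ⟨continuous_const, |a|, 0, fun x => by simp⟩

lemma PolyGrowth.sub {d : ℕ} {F G : (Fin d → ℝ) → ℝ} (hF : PolyGrowth F) (hG : PolyGrowth G) :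
    PolyGrowth (fun x => F x - G x) := by
  have := hF.add ((PolyGrowth.const (-1)).mul hG)
  convert this using 2
  ring

lemma PolyGrowth.coord {d : ℕ} (i : Fin d) : PolyGrowth (fun x : Fin d → ℝ => x i) :=
  ⟨continuous_apply i, 1, 1, fun x => by
    have := norm_le_pi_norm x i
    rw [Real.norm_eq_abs] at this
    linarith⟩

lemma PolyGrowth.sum {d : ℕ} {ι : Type*} (s : Finset ι) {F : ι → (Fin d → ℝ) → ℝ}
    (hF : ∀ i, PolyGrowth (F i)) : PolyGrowth (fun x => ∑ i ∈ s, F i x) := by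
  classical
  induction s using Finset.induction_on with
  | empty => simpa using PolyGrowth.const 0
  | insert a s ha ih => simpa [Finset.sum_insert ha] using (hF a).add ih

lemma PolyGrowth.dot {d : ℕ} (v : Fin d → ℝ) : PolyGrowth (fun x : Fin d → ℝ => v ⬝ᵥ x) :=
  PolyGrowth.sum _ fun i => (PolyGrowth.const (v i)).mul (PolyGrowth.coord i)

lemma PolyGrowth.quad {d : ℕ} (M : Matrix (Fin d) (Fin d) ℝ) :
    PolyGrowth (fun x : Fin d → ℝ => x ⬝ᵥ (M *ᵥ x)) :=
  PolyGrowth.sum _ fun i => (PolyGrowth.coord i).mul (PolyGrowth.dot (M i))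

lemma PolyGrowth.comp_affine {d : ℕ} {F : (Fin d → ℝ) → ℝ} (hF : PolyGrowth F)
    (m : Fin d → ℝ) (C : Matrix (Fin d) (Fin d) ℝ) :
    PolyGrowth (fun z => F (m + C *ᵥ z)) := by
  obtain ⟨c, n, hc, hb⟩ := hF.nonneg_bound
  let T : (Fin d → ℝ) →L[ℝ] (Fin d → ℝ) := LinearMap.toContinuousLinearMap (Matrix.mulVecLin C)
  have hT : ∀ z, C *ᵥ z = T z := fun z => rfl
  refine ⟨hF.1.comp (by simp only [hT]; fun_prop), c * (1 + ‖m‖ + ‖T‖) ^ n, n, fun z => ?_⟩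
  refine (hb _).trans ?_
  rw [mul_assoc, ← mul_pow, hT]
  gcongr
  have h1 : ‖m + T z‖ ≤ ‖m‖ + ‖T‖ * ‖z‖ := (norm_add_le _ _).trans (by
    gcongr; exact T.le_opNorm z)
  nlinarith [norm_nonneg m, norm_nonneg T, norm_nonneg z, mul_nonneg (norm_nonneg m) (norm_nonneg z)]

instance stdGaussian_isProb (d : ℕ) : IsProbabilityMeasure (stdGaussian d) := by
  unfold stdGaussian; infer_instance

instance stdGaussian_isGaussian (d : ℕ) : ProbabilityTheory.IsGaussian (stdGaussian d) := by
  have h := ProbabilityTheory.map_pi_eq_stdGaussian (ι := Fin d)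
  have h2 : stdGaussian d = (ProbabilityTheory.stdGaussian (EuclideanSpace ℝ (Fin d))).map
      (EuclideanSpace.equiv (Fin d) ℝ).toContinuousLinearMap := by
    rw [← h, Measure.map_map (by fun_prop) (by fun_prop)]
    have : (⇑(EuclideanSpace.equiv (Fin d) ℝ).toContinuousLinearMap ∘ WithLp.toLp 2) = id := by
      ext x; rfl
    rw [this, Measure.map_id]
    rfl
  rw [h2]
  infer_instance

lemma PolyGrowth.integrable {d : ℕ} {F : (Fin d → ℝ) → ℝ} (hF : PolyGrowth F) :
    Integrable F (stdGaussian d) := by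
  obtain ⟨c, n, hc, hb⟩ := hF.nonneg_bound
  have h1 : MemLp (fun x : Fin d → ℝ => 1 + ‖x‖) n (stdGaussian d) := by
    have h0 : MemLp (fun x : Fin d → ℝ => ‖x‖) n (stdGaussian d) :=
      (ProbabilityTheory.IsGaussian.memLp_id (stdGaussian d) n (ENNReal.natCast_ne_top n)).norm
    have hc1 : MemLp (fun _ : Fin d → ℝ => (1 : ℝ)) n (stdGaussian d) := memLp_const (1 : ℝ)
    have h3 := MemLp.add hc1 h0
    exact h3
  have h2 := (h1.integrable_norm_pow').const_mul c
  refine h2.mono' hF.1.aestronglyMeasurable (Filter.Eventually.of_forall fun x => ?_)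
  rw [Real.norm_eq_abs, Real.norm_of_nonneg (by positivity)]
  exact hb x

/-- The standard Gaussian density on `ℝ^d`. -/
def gaussDens {d : ℕ} (z : Fin d → ℝ) : ℝ := ∏ i, ProbabilityTheory.gaussianPDFReal 0 1 (z i)

lemma gaussDens_nonneg {d : ℕ} (z : Fin d → ℝ) : 0 ≤ gaussDens z :=
  Finset.prod_nonneg fun _ _ => ProbabilityTheory.gaussianPDFReal_nonneg _ _ _

lemma stdGaussian_eq_withDensity (d : ℕ) :
    stdGaussian d = (volume : Measure (Fin d → ℝ)).withDensity
      (fun z => ENNReal.ofReal (gaussDens z)) := by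
  unfold stdGaussian
  refine Measure.pi_eq fun s hs => ?_
  rw [withDensity_apply _ (MeasurableSet.univ_pi hs), volume_pi, Measure.restrict_pi_pi,
    ← ofReal_integral_eq_lintegral_ofReal]
  · unfold gaussDens
    rw [integral_fintype_prod_eq_prod (𝕜 := ℝ) (fun _ => ProbabilityTheory.gaussianPDFReal 0 1),
      ENNReal.ofReal_prod_of_nonneg]
    · refine Finset.prod_congr rfl fun i _ => ?_
      rw [ProbabilityTheory.gaussianReal_apply_eq_integral _ (by simp)]
    · intro i _
      exact integral_nonneg fun x => ProbabilityTheory.gaussianPDFReal_nonneg _ _ _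
  · exact Integrable.fintype_prod (𝕜 := ℝ) (f := fun _ => ProbabilityTheory.gaussianPDFReal 0 1)
      fun i => (ProbabilityTheory.integrable_gaussianPDFReal 0 1).restrict
  · exact Filter.Eventually.of_forall gaussDens_nonneg

lemma gaussDens_hasFDerivAt {d : ℕ} (z : Fin d → ℝ) :
    ∃ L : (Fin d → ℝ) →L[ℝ] ℝ, HasFDerivAt gaussDens L z ∧
      ∀ v, L v = - ((v ⬝ᵥ z) * gaussDens z) := by
  have heq : (gaussDens : (Fin d → ℝ) → ℝ) = fun z =>
      (∏ _i : Fin d, (√(2 * Real.pi))⁻¹) * Real.exp (- ∑ i, (z i) ^ 2 / 2) := by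
    ext z
    simp [gaussDens, ProbabilityTheory.gaussianPDFReal, ← Finset.sum_neg_distrib, Real.exp_sum,
      Finset.prod_mul_distrib, neg_div]
  have h1 : HasFDerivAt (fun z : Fin d → ℝ => - ∑ i, (z i) ^ 2 / 2)
      (- ∑ i, (z i) • ContinuousLinearMap.proj (R := ℝ) (φ := fun _ : Fin d => ℝ) i) z := by
    refine (HasFDerivAt.fun_sum fun i _ => ?_).neg
    have h := ((hasFDerivAt_apply (𝕜 := ℝ) (F' := fun _ : Fin d => ℝ) i z).pow 2).mul_const (2 : ℝ)⁻¹
    simp only [div_eq_mul_inv]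
    refine h.congr_fderiv ?_
    ext v
    simp
    try ring
  have h2 := (h1.exp).const_mul (∏ _i : Fin d, (√(2 * Real.pi))⁻¹)
  rw [heq]
  refine ⟨_, h2, fun v => ?_⟩
  simp [dotProduct]
  rw [Finset.sum_congr rfl fun i _ => mul_comm (z i) (v i)]
  ring

lemma integrable_dens {d : ℕ} {F : (Fin d → ℝ) → ℝ} (hF : Integrable F (stdGaussian d)) :
    Integrable (fun z => gaussDens z * F z) := by
  have hm : Measurable (gaussDens : (Fin d → ℝ) → ℝ) := by
    unfold gaussDens; fun_prop
  rw [stdGaussian_eq_withDensity,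
    integrable_withDensity_iff_integrable_smul' hm.ennreal_ofReal (by simp)] at hF
  simpa [ENNReal.toReal_ofReal (gaussDens_nonneg _)] using hF

lemma integral_dens {d : ℕ} (F : (Fin d → ℝ) → ℝ) :
    ∫ z, F z ∂(stdGaussian d) = ∫ z, gaussDens z * F z := by
  have hm : Measurable (gaussDens : (Fin d → ℝ) → ℝ) := by
    unfold gaussDens; fun_prop
  rw [stdGaussian_eq_withDensity,
    integral_withDensity_eq_integral_toReal_smul hm.ennreal_ofReal (by simp)]
  simp [ENNReal.toReal_ofReal (gaussDens_nonneg _)]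

/-- Gaussian integration by parts. -/
lemma stein {d : ℕ} {F : (Fin d → ℝ) → ℝ} (v : Fin d → ℝ) (hd : Differentiable ℝ F)
    (hF : PolyGrowth F) (hF' : PolyGrowth (fun z => fderiv ℝ F z v)) :
    ∫ z, (v ⬝ᵥ z) * F z ∂(stdGaussian d) = ∫ z, fderiv ℝ F z v ∂(stdGaussian d) := by
  have hder : ∀ z : Fin d → ℝ, fderiv ℝ gaussDens z v = - ((v ⬝ᵥ z) * gaussDens z) := fun z => by
    obtain ⟨L, hL, hv⟩ := gaussDens_hasFDerivAt z
    rw [hL.fderiv, hv]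
  have e1 : ∀ z : Fin d → ℝ, fderiv ℝ gaussDens z v * F z
      = - (gaussDens z * ((v ⬝ᵥ z) * F z)) := fun z => by rw [hder]; ring
  have i1 := integrable_dens ((PolyGrowth.dot v).mul hF).integrable
  have key := integral_mul_fderiv_eq_neg_fderiv_mul_of_integrable (μ := volume)
    (f := (gaussDens : (Fin d → ℝ) → ℝ)) (g := F) (v := v)
    (by simp only [e1]; exact i1.neg) (integrable_dens hF'.integrable)
    (integrable_dens hF.integrable)
    (fun z _ => (gaussDens_hasFDerivAt z).choose_spec.1.differentiableAt) (fun z _ => hd z)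
  rw [integral_dens, integral_dens, key]
  simp only [e1, integral_neg, neg_neg]

lemma fderiv_comp_affine {d : ℕ} {r : (Fin d → ℝ) → ℝ} (hr : Differentiable ℝ r)
    (m : Fin d → ℝ) (C : Matrix (Fin d) (Fin d) ℝ) :
    Differentiable ℝ (fun z => r (m + C *ᵥ z)) ∧
    ∀ z v, fderiv ℝ (fun z => r (m + C *ᵥ z)) z v = fderiv ℝ r (m + C *ᵥ z) (C *ᵥ v) := by
  let T : (Fin d → ℝ) →L[ℝ] (Fin d → ℝ) := LinearMap.toContinuousLinearMap (Matrix.mulVecLin C)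
  have h : ∀ z, HasFDerivAt (fun z => r (m + C *ᵥ z)) ((fderiv ℝ r (m + C *ᵥ z)).comp T) z :=
    fun z => (hr (m + C *ᵥ z)).hasFDerivAt.comp z (T.hasFDerivAt.const_add m)
  exact ⟨fun z => (h z).differentiableAt, fun z v => by rw [(h z).fderiv]; rfl⟩

lemma hasFDerivAt_dot {d : ℕ} (v z : Fin d → ℝ) :
    HasFDerivAt (fun z : Fin d → ℝ => v ⬝ᵥ z)
      (LinearMap.toContinuousLinearMap (dotProductBilin ℝ ℝ v)) z :=
  (LinearMap.toContinuousLinearMap (dotProductBilin ℝ ℝ v)).hasFDerivAt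

lemma orth_derivs {d : ℕ} (m : Fin d → ℝ) (C : Matrix (Fin d) (Fin d) ℝ) (hC : IsUnit C.det)
    (r : (Fin d → ℝ) → ℝ) (r1 : Fin d → (Fin d → ℝ) → ℝ) (r2 : Fin d → Fin d → (Fin d → ℝ) → ℝ)
    (hr : Differentiable ℝ r) (hr1 : ∀ j, Differentiable ℝ (r1 j))
    (e1 : ∀ j y, fderiv ℝ r y (Pi.single j 1) = r1 j y)
    (e2 : ∀ j k y, fderiv ℝ (r1 k) y (Pi.single j 1) = r2 j k y)
    (p0 : PolyGrowth r) (p1 : ∀ j, PolyGrowth (r1 j)) (p2 : ∀ j k, PolyGrowth (r2 j k))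
    (horth : ∀ (a : ℝ) (b : Fin d → ℝ) (M : Matrix (Fin d) (Fin d) ℝ), M.IsSymm →
      ∫ z, r (m + C *ᵥ z) * (a + b ⬝ᵥ (m + C *ᵥ z) + (m + C *ᵥ z) ⬝ᵥ (M *ᵥ (m + C *ᵥ z)))
        ∂stdGaussian d = 0) :
    (∀ j, ∫ z, r1 j (m + C *ᵥ z) ∂stdGaussian d = 0) ∧
    (∀ j k, ∫ z, r2 j k (m + C *ᵥ z) ∂stdGaussian d = 0) := by
  set v : Fin d → Fin d → ℝ := fun j => C⁻¹ *ᵥ Pi.single j 1 with hv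
  have hCv : ∀ j, C *ᵥ v j = Pi.single j 1 := fun j => by
    rw [hv, Matrix.mulVec_mulVec, Matrix.mul_nonsing_inv _ hC, Matrix.one_mulVec]
  set w : Fin d → Fin d → ℝ := fun j => v j ᵥ* C⁻¹ with hw
  have hvz : ∀ j z, v j ⬝ᵥ z = w j ⬝ᵥ (m + C *ᵥ z) - w j ⬝ᵥ m := fun j z => by
    rw [dotProduct_add, add_sub_cancel_left, hw, ← Matrix.dotProduct_mulVec, Matrix.mulVec_mulVec,
      Matrix.nonsing_inv_mul _ hC, Matrix.one_mulVec]
  obtain ⟨hd, hfd⟩ := fderiv_comp_affine hr m C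
  have q0 := p0.comp_affine m C
  have q1 : ∀ j, PolyGrowth (fun z => r1 j (m + C *ᵥ z)) := fun j => (p1 j).comp_affine m C
  have q2 : ∀ j k, PolyGrowth (fun z => r2 j k (m + C *ᵥ z)) :=
    fun j k => (p2 j k).comp_affine m C
  have d1 : ∀ j z, fderiv ℝ (fun z => r (m + C *ᵥ z)) z (v j) = r1 j (m + C *ᵥ z) := fun j z => by
    rw [hfd, hCv, e1]
  have d2 : ∀ j k z, fderiv ℝ (fun z => r1 k (m + C *ᵥ z)) z (v j) = r2 j k (m + C *ᵥ z) :=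
    fun j k z => by rw [(fderiv_comp_affine (hr1 k) m C).2, hCv, e2]
  have o0 : ∫ z, r (m + C *ᵥ z) ∂stdGaussian d = 0 := by
    have := horth 1 0 0 Matrix.isSymm_zero
    simpa using this
  have o1 : ∀ j, ∫ z, (v j ⬝ᵥ z) * r (m + C *ᵥ z) ∂stdGaussian d = 0 := fun j => by
    rw [← horth (-(w j ⬝ᵥ m)) (w j) 0 Matrix.isSymm_zero]
    refine integral_congr_ae (Filter.Eventually.of_forall fun z => ?_)
    simp only [hvz, Matrix.zero_mulVec, dotProduct_zero]
    ring
  have o2 : ∀ j k, ∫ z, (v j ⬝ᵥ z) * ((v k ⬝ᵥ z) * r (m + C *ᵥ z)) ∂stdGaussian d = 0 := by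
    intro j k
    rw [← horth ((w j ⬝ᵥ m) * (w k ⬝ᵥ m)) (-(w k ⬝ᵥ m) • w j - (w j ⬝ᵥ m) • w k)
      ((1 / 2 : ℝ) • (vecMulVec (w j) (w k) + vecMulVec (w k) (w j)))
      (by
        ext a b
        simp [vecMulVec_apply]
        ring)]
    refine integral_congr_ae (Filter.Eventually.of_forall fun z => ?_)
    have hM : ∀ x : Fin d → ℝ, x ⬝ᵥ (((1 / 2 : ℝ) •
        (vecMulVec (w j) (w k) + vecMulVec (w k) (w j))) *ᵥ x) = (w j ⬝ᵥ x) * (w k ⬝ᵥ x) := by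
      intro x
      simp [Matrix.smul_mulVec, Matrix.add_mulVec, Matrix.vecMulVec_mulVec, dotProduct_comm x]
      ring
    simp only [hvz, hM, sub_dotProduct, smul_dotProduct, smul_eq_mul]
    ring
  have s1 : ∀ j, ∫ z, r1 j (m + C *ᵥ z) ∂stdGaussian d = 0 := fun j => by
    have := stein (v j) hd q0 (by simp only [d1]; exact q1 j)
    rw [o1] at this
    simp only [d1] at this
    exact this.symm
  refine ⟨s1, fun k j => ?_⟩
  have dd : ∀ z, fderiv ℝ (fun z => (v k ⬝ᵥ z) * r (m + C *ᵥ z)) z (v j)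
      = (v k ⬝ᵥ z) * r1 j (m + C *ᵥ z) + (v k ⬝ᵥ v j) * r (m + C *ᵥ z) := fun z => by
    rw [((hasFDerivAt_dot (v k) z).fun_mul (hd z).hasFDerivAt).fderiv]
    simp [d1, mul_comm]
  have i1 : PolyGrowth (fun z => (v k ⬝ᵥ z) * r1 j (m + C *ᵥ z)) := (PolyGrowth.dot _).mul (q1 j)
  have i2 : PolyGrowth (fun z => (v k ⬝ᵥ v j) * r (m + C *ᵥ z)) := (PolyGrowth.const _).mul q0
  have st := stein (v j) (F := fun z => (v k ⬝ᵥ z) * r (m + C *ᵥ z))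
    (fun z => ((hasFDerivAt_dot (v k) z).fun_mul (hd z).hasFDerivAt).differentiableAt)
    ((PolyGrowth.dot _).mul q0) (by simp only [dd]; exact i1.add i2)
  rw [o2] at st
  simp only [dd] at st
  rw [integral_add i1.integrable i2.integrable, integral_const_mul, o0, mul_zero, add_zero,
    stein (v k) (fderiv_comp_affine (hr1 j) m C).1 (q1 j) (by simp only [d2]; exact q2 k j)] at st
  simp only [d2] at st
  exact st.symm

lemma orth_of_min {d : ℕ} {R P : (Fin d → ℝ) → ℝ} (hR : PolyGrowth R) (hP : PolyGrowth P)
    (h : ∀ t : ℝ, ∫ z, (R z) ^ 2 ∂stdGaussian d ≤ ∫ z, (R z + t * P z) ^ 2 ∂stdGaussian d) :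
    ∫ z, R z * P z ∂stdGaussian d = 0 := by
  have i1 := (hR.mul hR).integrable
  have i2 := (hR.mul hP).integrable
  have i3 := (hP.mul hP).integrable
  set A := ∫ z, R z * P z ∂stdGaussian d
  set B := ∫ z, P z * P z ∂stdGaussian d
  have hB : 0 ≤ B := integral_nonneg fun z => mul_self_nonneg _
  have key : ∀ t : ℝ, 0 ≤ 2 * t * A + t ^ 2 * B := fun t => by
    have h1 := h t
    have : ∫ z, (R z + t * P z) ^ 2 ∂stdGaussian d
        = (∫ z, (R z) ^ 2 ∂stdGaussian d) + (2 * t * A + t ^ 2 * B) := by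
      rw [← integral_const_mul, ← integral_const_mul,
        ← integral_add (i2.const_mul _) (i3.const_mul _), ← integral_add]
      · refine integral_congr_ae (Filter.Eventually.of_forall fun z => ?_)
        simp only
        ring
      · simpa only [sq] using i1
      · exact (i2.const_mul _).add (i3.const_mul _)
    linarith
  have h2 := key (-A / (B + 1))
  have h3 : 2 * (-A / (B + 1)) * A + (-A / (B + 1)) ^ 2 * B = - (A ^ 2 * (B + 2)) / (B + 1) ^ 2 := by
    field_simp
    ring
  rw [h3, div_nonneg_iff] at h2
  have h4 : 0 < (B + 1) ^ 2 := by positivity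
  have h5 : A ^ 2 * (B + 2) ≤ 0 := by
    rcases h2 with h2 | h2
    · linarith [h2.1]
    · linarith [h2.2]
  have : A ^ 2 ≤ 0 := by nlinarith [sq_nonneg A]
  nlinarith [sq_nonneg A, pow_eq_zero_iff (two_ne_zero) |>.1 (le_antisymm this (sq_nonneg A))]

lemma hasFDerivAt_quad {d : ℕ} (Θ : Matrix (Fin d) (Fin d) ℝ) (hΘ : Θ.IsSymm) (x : Fin d → ℝ) :
    ∃ L : (Fin d → ℝ) →L[ℝ] ℝ, HasFDerivAt (fun x : Fin d → ℝ => x ⬝ᵥ (Θ *ᵥ x)) L x ∧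
      ∀ k, L (Pi.single k 1) = 2 * (Θ k ⬝ᵥ x) := by
  have h : HasFDerivAt (fun x : Fin d → ℝ => ∑ i, x i * (Θ i ⬝ᵥ x)) _ x :=
    HasFDerivAt.fun_sum (u := Finset.univ) fun i _ =>
      (hasFDerivAt_apply (𝕜 := ℝ) (F' := fun _ : Fin d => ℝ) i x).fun_mul (hasFDerivAt_dot (Θ i) x)
  refine ⟨_, h, fun k => ?_⟩
  have : ∑ i, x i * Θ i k = Θ k ⬝ᵥ x := by
    simp only [dotProduct]
    refine Finset.sum_congr rfl fun i _ => ?_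
    rw [← hΘ.apply i k, mul_comm]
  simp [Finset.sum_add_distrib, Pi.single_apply, this]
  ring

lemma main_eqs
    {d : ℕ} (μv : Fin d → ℝ) (C : Matrix (Fin d) (Fin d) ℝ) (hC : IsUnit C.det)
    (f : (Fin d → ℝ) → ℝ) (hf : ContDiff ℝ 2 f)
    (c : ℝ) (n : ℕ)
    (hbound : ∀ x : Fin d → ℝ,
      |f x| ≤ c * (1 + ‖x‖) ^ n ∧ ‖fderiv ℝ f x‖ ≤ c * (1 + ‖x‖) ^ n ∧
        ‖fderiv ℝ (fderiv ℝ f) x‖ ≤ c * (1 + ‖x‖) ^ n)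
    (β0 : ℝ) (β1 : Fin d → ℝ) (Θ : Matrix (Fin d) (Fin d) ℝ) (hΘsymm : Θ.IsSymm)
    (hmin : ∀ (a : ℝ) (b : Fin d → ℝ) (M : Matrix (Fin d) (Fin d) ℝ), M.IsSymm →
      (∫ z, (β0 + β1 ⬝ᵥ (μv + C *ᵥ z) + (μv + C *ᵥ z) ⬝ᵥ (Θ *ᵥ (μv + C *ᵥ z))
          - f (μv + C *ᵥ z)) ^ 2 ∂stdGaussian d)
        ≤ ∫ z, (a + b ⬝ᵥ (μv + C *ᵥ z) + (μv + C *ᵥ z) ⬝ᵥ (M *ᵥ (μv + C *ᵥ z))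
            - f (μv + C *ᵥ z)) ^ 2 ∂stdGaussian d) :
    (∀ j, ∫ z, fderiv ℝ f (μv + C *ᵥ z) (Pi.single j 1) ∂stdGaussian d
      = β1 j + 2 * (Θ j ⬝ᵥ μv)) ∧
    (∀ j k, ∫ z, fderiv ℝ (fun y => fderiv ℝ f y (Pi.single k 1)) (μv + C *ᵥ z)
        (Pi.single j 1) ∂stdGaussian d = 2 * Θ k j) := by
  have hfd : Differentiable ℝ f := hf.differentiable (by norm_num)
  have hf1 : ContDiff ℝ 1 (fderiv ℝ f) := hf.fderiv_right (by norm_num)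
  have hf1d : Differentiable ℝ (fderiv ℝ f) := hf1.differentiable (by norm_num)
  have hf2c : Continuous (fderiv ℝ (fderiv ℝ f)) := hf1.continuous_fderiv (by norm_num)
  have hkd : ∀ k : Fin d, Differentiable ℝ (fun y => fderiv ℝ f y (Pi.single k 1)) :=
    fun k => hf1d.clm_apply (differentiable_const _)
  have hD2 : ∀ (j k : Fin d) y, fderiv ℝ (fun y => fderiv ℝ f y (Pi.single k 1)) y (Pi.single j 1)
      = fderiv ℝ (fderiv ℝ f) y (Pi.single j 1) (Pi.single k 1) := fun j k y => by
    have := ((hf1d y).hasFDerivAt).clm_apply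
      (hasFDerivAt_const (Pi.single k (1:ℝ) : Fin d → ℝ) y)
    rw [this.fderiv]
    simp
  have hs : ∀ k : Fin d, ‖(Pi.single k (1:ℝ) : Fin d → ℝ)‖ = 1 := fun k => by
    rw [Pi.norm_single]; simp
  have pf : PolyGrowth f := ⟨hf.continuous, c, n, fun x => (hbound x).1⟩
  have pf1 : ∀ k : Fin d, PolyGrowth (fun y => fderiv ℝ f y (Pi.single k 1)) := fun k =>
    ⟨(hkd k).continuous, c, n, fun x => by
      have := (fderiv ℝ f x).le_opNorm (Pi.single k 1)
      rw [hs, mul_one, Real.norm_eq_abs] at this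
      exact this.trans (hbound x).2.1⟩
  have pf2 : ∀ j k : Fin d, PolyGrowth (fun y =>
      fderiv ℝ (fun y => fderiv ℝ f y (Pi.single k 1)) y (Pi.single j 1)) := fun j k => by
    simp only [hD2]
    refine ⟨(hf2c.clm_apply continuous_const).clm_apply continuous_const, c, n, fun x => ?_⟩
    have := (fderiv ℝ (fderiv ℝ f) x).le_opNorm₂ (Pi.single j 1) (Pi.single k 1)
    rw [hs, hs, mul_one, mul_one, Real.norm_eq_abs] at this
    exact this.trans (hbound x).2.2
  have pquad : ∀ a b M, PolyGrowth (fun x : Fin d → ℝ => a + b ⬝ᵥ x + x ⬝ᵥ (M *ᵥ x)) :=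
    fun a b M => ((PolyGrowth.const a).add (PolyGrowth.dot b)).add (PolyGrowth.quad M)
  have p0 : PolyGrowth (fun x => β0 + β1 ⬝ᵥ x + x ⬝ᵥ (Θ *ᵥ x) - f x) := (pquad _ _ _).sub pf
  have plin : ∀ k, PolyGrowth (fun x => β1 k + 2 * (Θ k ⬝ᵥ x)) := fun k =>
    (PolyGrowth.const _).add ((PolyGrowth.const 2).mul (PolyGrowth.dot _))
  have hr : ∀ x, ∃ L : (Fin d → ℝ) →L[ℝ] ℝ,
      HasFDerivAt (fun x => β0 + β1 ⬝ᵥ x + x ⬝ᵥ (Θ *ᵥ x) - f x) L x ∧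
      ∀ k, L (Pi.single k 1) = β1 k + 2 * (Θ k ⬝ᵥ x) - fderiv ℝ f x (Pi.single k 1) := fun x => by
    obtain ⟨L, hL, hk⟩ := hasFDerivAt_quad Θ hΘsymm x
    refine ⟨_, (((hasFDerivAt_dot β1 x).const_add β0).fun_add hL).fun_sub (hfd x).hasFDerivAt,
      fun k => ?_⟩
    simp [hk]
  have hr1 : ∀ k x, HasFDerivAt
      (fun x => β1 k + 2 * (Θ k ⬝ᵥ x) - fderiv ℝ f x (Pi.single k 1)) _ x := fun k x =>
    (((hasFDerivAt_dot (Θ k) x).const_mul 2).const_add (β1 k)).fun_sub (hkd k x).hasFDerivAt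
  obtain ⟨A, B⟩ := orth_derivs μv C hC (fun x => β0 + β1 ⬝ᵥ x + x ⬝ᵥ (Θ *ᵥ x) - f x)
    (fun k x => β1 k + 2 * (Θ k ⬝ᵥ x) - fderiv ℝ f x (Pi.single k 1))
    (fun j k x => 2 * Θ k j - fderiv ℝ (fun y => fderiv ℝ f y (Pi.single k 1)) x (Pi.single j 1))
    (fun x => (hr x).choose_spec.1.differentiableAt)
    (fun k x => (hr1 k x).differentiableAt)
    (fun k x => by
      obtain ⟨L, hL, hk⟩ := hr x
      rw [hL.fderiv, hk])
    (fun j k x => by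
      rw [(hr1 k x).fderiv]
      simp)
    p0 (fun k => (plin k).sub (pf1 k)) (fun j k => (PolyGrowth.const _).sub (pf2 j k))
    (fun a b M hM => by
      refine orth_of_min (p0.comp_affine μv C) ((pquad a b M).comp_affine μv C) fun t => ?_
      refine (hmin (β0 + t * a) (β1 + t • b) (Θ + t • M) (hΘsymm.add (hM.smul t))).trans_eq ?_
      refine integral_congr_ae (Filter.Eventually.of_forall fun z => ?_)
      simp only [add_dotProduct, smul_dotProduct, Matrix.add_mulVec, Matrix.smul_mulVec,
        dotProduct_add, dotProduct_smul, smul_eq_mul]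
      ring)
  have hz : ∀ w : Fin d → ℝ, ∫ z, w ⬝ᵥ z ∂stdGaussian d = 0 := fun w => by
    have := stein w (F := fun _ => (1:ℝ)) (differentiable_const _) (PolyGrowth.const 1)
      (by simpa using PolyGrowth.const 0)
    simpa using this
  constructor
  · intro j
    have h := A j
    rw [integral_sub ((plin j).comp_affine μv C).integrable ((pf1 j).comp_affine μv C).integrable,
      sub_eq_zero] at h
    rw [← h, integral_add (integrable_const _)
      (((PolyGrowth.const 2).mul (PolyGrowth.dot (Θ j))).comp_affine μv C).integrable,
      integral_const_mul]
    simp only [dotProduct_add, Matrix.dotProduct_mulVec]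
    rw [integral_add (integrable_const _) (PolyGrowth.dot _).integrable, hz]
    simp
  · intro j k
    have h := B j k
    rw [integral_sub (integrable_const _) ((pf2 j k).comp_affine μv C).integrable,
      sub_eq_zero] at h
    rw [← h]
    simp

/-- With `X = μ + C Z`, `C` invertible, `f` twice continuously
differentiable with polynomially bounded `|f|`, `‖∇f‖`, `‖∇²f‖`, and
`H = E[∇²f(X)]` negative definite, the unique minimiser `(β⁰, β¹, Θ)` (with `Θ`
symmetric) of `E[(a + b ⬝ X + Xᵀ M X − f(X))²]` satisfies `Θ = ½ H` and
`β¹ = g − H μ` where `g = E[∇f(X)]`; consequently the Gaussian density proportional to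
`exp(β¹ ⬝ x + xᵀ Θ x)` has mean `μ' = −½ Θ⁻¹ β¹ = μ − H⁻¹ g` and covariance
`Σ' = −½ Θ⁻¹ = −H⁻¹`. -/
theorem stmt17
    {d : ℕ} (μv : Fin d → ℝ) (C : Matrix (Fin d) (Fin d) ℝ) (hC : IsUnit C.det)
    (f : (Fin d → ℝ) → ℝ) (hf : ContDiff ℝ 2 f)
    (c : ℝ) (n : ℕ)
    (hbound : ∀ x : Fin d → ℝ,
      |f x| ≤ c * (1 + ‖x‖) ^ n ∧ ‖fderiv ℝ f x‖ ≤ c * (1 + ‖x‖) ^ n ∧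
        ‖fderiv ℝ (fderiv ℝ f) x‖ ≤ c * (1 + ‖x‖) ^ n)
    -- `g = E[∇f(X)]` and `H = E[∇²f(X)]`, negative definite
    (gv : Fin d → ℝ)
    (hgv : gv = fun j => ∫ z, fderiv ℝ f (μv + C *ᵥ z) (Pi.single j 1) ∂stdGaussian d)
    (H : Matrix (Fin d) (Fin d) ℝ)
    (hH : H = Matrix.of fun j k =>
      ∫ z, fderiv ℝ (fun y => fderiv ℝ f y (Pi.single k 1)) (μv + C *ᵥ z)
        (Pi.single j 1) ∂stdGaussian d)
    (hHneg : (-H).PosDef)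
    -- `(β⁰, β¹, Θ)`, `Θ` symmetric, is the unique minimiser of the least-squares objective
    (β0 : ℝ) (β1 : Fin d → ℝ) (Θ : Matrix (Fin d) (Fin d) ℝ) (hΘsymm : Θ.IsSymm)
    (hmin : ∀ (a : ℝ) (b : Fin d → ℝ) (M : Matrix (Fin d) (Fin d) ℝ), M.IsSymm →
      (∫ z, (β0 + β1 ⬝ᵥ (μv + C *ᵥ z) + (μv + C *ᵥ z) ⬝ᵥ (Θ *ᵥ (μv + C *ᵥ z))
          - f (μv + C *ᵥ z)) ^ 2 ∂stdGaussian d)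
        ≤ ∫ z, (a + b ⬝ᵥ (μv + C *ᵥ z) + (μv + C *ᵥ z) ⬝ᵥ (M *ᵥ (μv + C *ᵥ z))
            - f (μv + C *ᵥ z)) ^ 2 ∂stdGaussian d)
    (huniq : ∀ (a : ℝ) (b : Fin d → ℝ) (M : Matrix (Fin d) (Fin d) ℝ), M.IsSymm →
      (∀ (a' : ℝ) (b' : Fin d → ℝ) (M' : Matrix (Fin d) (Fin d) ℝ), M'.IsSymm →
        (∫ z, (a + b ⬝ᵥ (μv + C *ᵥ z) + (μv + C *ᵥ z) ⬝ᵥ (M *ᵥ (μv + C *ᵥ z))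
            - f (μv + C *ᵥ z)) ^ 2 ∂stdGaussian d)
          ≤ ∫ z, (a' + b' ⬝ᵥ (μv + C *ᵥ z) + (μv + C *ᵥ z) ⬝ᵥ (M' *ᵥ (μv + C *ᵥ z))
              - f (μv + C *ᵥ z)) ^ 2 ∂stdGaussian d) →
      a = β0 ∧ b = β1 ∧ M = Θ) :
    Θ = (1 / 2 : ℝ) • H
    ∧ β1 = gv - H *ᵥ μv
    ∧ (-(1 / 2 : ℝ)) • (Θ⁻¹ *ᵥ β1) = μv - H⁻¹ *ᵥ gv
    ∧ (-(1 / 2 : ℝ)) • Θ⁻¹ = -H⁻¹ := by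
  obtain ⟨A, B⟩ := main_eqs μv C hC f hf c n hbound β0 β1 Θ hΘsymm hmin
  have hHΘ : H = (2 : ℝ) • Θ := by
    ext j k
    rw [hH, Matrix.of_apply, B, ← hΘsymm.apply k j]
    simp
  have e1 : Θ = (1 / 2 : ℝ) • H := by
    rw [hHΘ, smul_smul]; norm_num
  have e2 : β1 = gv - H *ᵥ μv := by
    ext j
    have : (H *ᵥ μv) j = 2 * (Θ j ⬝ᵥ μv) := by
      rw [hHΘ, Matrix.smul_mulVec]; rfl
    rw [Pi.sub_apply, this, hgv]
    simp only [A]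
    ring
  have hdet : IsUnit H.det := by
    have h := hHneg.isUnit
    rw [IsUnit.neg_iff] at h
    exact (Matrix.isUnit_iff_isUnit_det H).1 h
  have hinv : Θ⁻¹ = (2 : ℝ) • H⁻¹ := by
    refine Matrix.inv_eq_right_inv ?_
    rw [e1, Matrix.smul_mul, Matrix.mul_smul, smul_smul, Matrix.mul_nonsing_inv _ hdet]
    norm_num
  refine ⟨e1, e2, ?_, ?_⟩
  · rw [hinv, e2, Matrix.smul_mulVec, smul_smul, Matrix.mulVec_sub, Matrix.mulVec_mulVec,
      Matrix.nonsing_inv_mul _ hdet, Matrix.one_mulVec]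
    norm_num
  · rw [hinv, smul_smul]
    norm_num
end
end
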